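/- arXiv:1806.11435 — 2 statements merged into one kernel-verified Lean document; each statement's English description precedes it below -/
import Mathlib

section
/- Let X be a topological space, let 𝒰 be a basis of the topology of X, and let P be a predicate on the open subsets of X satisfying: (i) the local condition: P(U₁ ∩ … ∩ U_l) holds for any finitely many U₁, …, U_l ∈ 𝒰; (ii) the Mayer–Vietoris condition: for any open subsets U, V of X, if P(U), P(V) and P(U ∩ V) hold, then P(U ∪ V) holds. Let 𝒰_f denote the collection of all open sets that are finite unions of members of 𝒰. Then P(V) holds for every open set V that is a finite intersection V = W₁ ∩ … ∩ W_s of members W₁, …, W_s of 𝒰_f. -/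
/-- A predicate satisfying the Mayer–Vietoris condition which holds on an intersection-closed
family of open sets holds on all finite nonempty unions of members of that family. -/
theorem mayerVietoris_biUnion_of_infClosed {X ι : Type*} [TopologicalSpace X]
    {P : Set X → Prop} {S : Set (Set X)} (hS : InfClosed S)
    (hopen : ∀ U ∈ S, IsOpen U) (hP : ∀ U ∈ S, P U)
    (hMV : ∀ U V : Set X, IsOpen U → IsOpen V → P U → P V → P (U ∩ V) → P (U ∪ V))
    {t : Finset ι} (ht : t.Nonempty) (f : ι → Set X) (hf : ∀ i ∈ t, f i ∈ S) :
    P (⋃ i ∈ t, f i) := by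
  induction ht using Finset.Nonempty.cons_induction generalizing f with
  | singleton a => simpa using hP _ (hf a (by simp))
  | cons a t ha ht ih =>
    have hfa : f a ∈ S := hf a (by simp)
    have hft : ∀ i ∈ t, f i ∈ S := fun i hi => hf i (by simp [hi])
    have hunion : ⋃ i ∈ Finset.cons a t ha, f i = f a ∪ ⋃ i ∈ t, f i := by
      ext x; simp
    rw [hunion]
    refine hMV _ _ (hopen _ hfa) (isOpen_biUnion fun i hi => hopen _ (hft i hi))
      (hP _ hfa) (ih f hft) ?_
    rw [Set.inter_iUnion₂]
    exact ih (fun i => f a ∩ f i) fun i hi => hS hfa (hft i hi)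

/-- Every member of the closure of `S` under finite nonempty infima is an intersection
indexed by some `Fin (l + 1)`. -/
theorem exists_fin_iInter_eq_of_mem_infClosure {X : Type*} {S : Set (Set X)} {A : Set X}
    (hA : A ∈ infClosure S) :
    ∃ (l : ℕ) (U : Fin (l + 1) → Set X), (∀ i, U i ∈ S) ∧ A = ⋂ i, U i := by
  obtain ⟨t, ht, htS, rfl⟩ := hA
  obtain ⟨l, hl⟩ := Nat.exists_eq_succ_of_ne_zero ht.card_pos.ne'
  let e := t.equivFinOfCardEq hl
  refine ⟨l, fun i => e.symm i, fun i => htS (e.symm i).2, ?_⟩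
  rw [e.symm.surjective.iInter_comp (fun x : t => (x : Set X)), Finset.inf'_eq_inf,
    Finset.inf_id_set_eq_sInter, Set.sInter_eq_iInter]
  rfl

/-- Claim (**) in the proof of the gluing principle: if `P` satisfies the local
condition for a basis `𝒰` of the topology and the Mayer–Vietoris condition,
then `P` holds for every finite intersection of open sets that are finite
unions of members of `𝒰`. -/
theorem gluing_finite_intersection_of_finite_unions {X : Type*}
    [TopologicalSpace X] (𝒰 : Set (Set X))
    (hbasis : TopologicalSpace.IsTopologicalBasis 𝒰)
    (P : Set X → Prop)
    (hloc : ∀ (l : ℕ) (U : Fin (l + 1) → Set X), (∀ i, U i ∈ 𝒰) → P (⋂ i, U i))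
    (hMV : ∀ U V : Set X, IsOpen U → IsOpen V →
      P U → P V → P (U ∩ V) → P (U ∪ V))
    (s : ℕ) (W : Fin (s + 1) → Set X)
    (hW : ∀ i, ∃ (m : ℕ) (V : Fin (m + 1) → Set X),
      (∀ j, V j ∈ 𝒰) ∧ W i = ⋃ j, V j) :
    P (⋂ i, W i) := by
  have hopen : ∀ U ∈ infClosure 𝒰, IsOpen U := fun U hU => by
    obtain ⟨l, V, hV, rfl⟩ := exists_fin_iInter_eq_of_mem_infClosure hU
    exact isOpen_iInter_of_finite fun i => hbasis.isOpen (hV i)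
  have hP : ∀ U ∈ infClosure 𝒰, P U := fun U hU => by
    obtain ⟨l, V, hV, rfl⟩ := exists_fin_iInter_eq_of_mem_infClosure hU
    exact hloc l V hV
  have hWmem : ∀ i, W i ∈ supClosure (infClosure 𝒰) := fun i => by
    obtain ⟨m, V, hV, hWi⟩ := hW i
    rw [hWi, Set.iUnion, ← Finset.sup'_univ_eq_ciSup]
    exact supClosed_supClosure.finsetSup'_mem Finset.univ_nonempty
      fun j _ => subset_supClosure (subset_infClosure (hV j))
  have hmem : ⋂ i, W i ∈ supClosure (infClosure 𝒰) := by
    rw [Set.iInter, ← Finset.inf'_univ_eq_ciInf]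
    exact infClosed_infClosure.supClosure.finsetInf'_mem Finset.univ_nonempty
      fun i _ => hWmem i
  obtain ⟨t, ht, htS, hteq⟩ := hmem
  rw [← hteq, Finset.sup'_eq_sup, Finset.sup_id_set_eq_sUnion, Set.sUnion_eq_biUnion]
  exact mayerVietoris_biUnion_of_infClosed infClosed_infClosure hopen hP hMV ht id
    fun i hi => htS hi
end

section
/- Let X be a topological space, let 𝒰 be a basis of the topology of X, and let P be a predicate on the open subsets of X satisfying: (i) the local condition: P(U₁ ∩ … ∩ U_l) holds for any finitely many U₁, …, U_l ∈ 𝒰; (ii) the disjoint condition: if {Uₙ | n ∈ ℕ} is a countable collection of pairwise disjoint open subsets of X and P(Uₙ) holds for every n, then P(⋃ₙ Uₙ) holds; (iii) the Mayer–Vietoris condition: for any open subsets U, V of X, if P(U), P(V) and P(U ∩ V) hold, then P(U ∪ V) holds. Suppose that X can be written as X = V₁ ∪ … ∪ V_l, where each V_i is a countable disjoint union of open sets, each of which is a finite union of members of 𝒰. Then P(X) holds. -/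
/-- A predicate with the Mayer–Vietoris property that holds on a family of open sets closed under
binary intersections holds on the nonempty finite unions of members of that family. -/
theorem sup'_of_infClosed {X ι : Type*} [TopologicalSpace X] {P : Set X → Prop} {C : Set (Set X)}
    (hMV : ∀ U V : Set X, IsOpen U → IsOpen V → P U → P V → P (U ∩ V) → P (U ∪ V))
    (hC : InfClosed C) (hopen : ∀ U ∈ C, IsOpen U) (hP : ∀ U ∈ C, P U)
    {t : Finset ι} (ht : t.Nonempty) (f : ι → Set X) (hf : ∀ i ∈ t, f i ∈ C) :
    P (t.sup' ht f) := by
  induction ht using Finset.Nonempty.cons_induction generalizing f with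
  | singleton a => simpa using hP _ (hf a (by simp))
  | cons a s ha hs ih =>
    have hfa : f a ∈ C := hf a (by simp)
    have hfs : ∀ i ∈ s, f i ∈ C := fun i hi => hf i (by simp [hi])
    rw [Finset.sup'_cons hs]
    refine hMV _ _ (hopen _ hfa) ?_ (hP _ hfa) (ih f hfs) ?_
    · rw [Finset.sup'_eq_sup, Finset.sup_set_eq_biUnion]
      exact isOpen_biUnion fun i hi => hopen _ (hfs i hi)
    · change P (f a ⊓ s.sup' hs f)
      rw [Finset.sup'_inf_distrib_left]
      exact ih _ fun i hi => hC hfa (hfs i hi)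

/-- The unions of pairwise disjoint sequences of members of a family closed under binary
intersections are again closed under binary intersections. -/
theorem infClosed_iUnion_disjoint {X : Type*} {C : Set (Set X)} (hC : InfClosed C) :
    InfClosed {V : Set X | ∃ W : ℕ → Set X, (∀ m, W m ∈ C) ∧
      Pairwise (Function.onFun Disjoint W) ∧ V = ⋃ m, W m} := by
  rintro _ ⟨W, hW, hWd, rfl⟩ _ ⟨W', hW', hWd', rfl⟩
  refine ⟨fun m => W m.unpair.1 ∩ W' m.unpair.2, fun m => hC (hW _) (hW' _), ?_, ?_⟩
  · intro m n hmn
    by_cases h : m.unpair.1 = n.unpair.1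
    · have h' : m.unpair.2 ≠ n.unpair.2 := fun h' => hmn <| by
        rw [← Nat.pair_unpair m, ← Nat.pair_unpair n, h, h']
      exact (hWd' h').mono Set.inter_subset_right Set.inter_subset_right
    · exact (hWd h).mono Set.inter_subset_left Set.inter_subset_left
  · exact (Set.iUnion_inter_iUnion W W').trans (Set.iUnion_unpair fun i j => W i ∩ W' j).symm

/-- The final assembly step of the gluing principle: if `P` satisfies the local
condition for a basis `𝒰`, the disjoint condition and the Mayer–Vietoris
condition, and `X` is covered by finitely many open sets, each of which is a
countable disjoint union of open sets that are finite unions of members of `𝒰`,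
then `P X` holds. -/
theorem gluing_of_cover {X : Type*} [TopologicalSpace X] (𝒰 : Set (Set X))
    (hbasis : TopologicalSpace.IsTopologicalBasis 𝒰)
    (P : Set X → Prop)
    (hloc : ∀ (l : ℕ) (U : Fin (l + 1) → Set X), (∀ i, U i ∈ 𝒰) → P (⋂ i, U i))
    (hdisj : ∀ U : ℕ → Set X, (∀ m, IsOpen (U m)) →
      Pairwise (Function.onFun Disjoint U) → (∀ m, P (U m)) → P (⋃ m, U m))
    (hMV : ∀ U V : Set X, IsOpen U → IsOpen V →
      P U → P V → P (U ∩ V) → P (U ∪ V))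
    (l : ℕ) (V : Fin (l + 1) → Set X)
    (hcover : ⋃ i, V i = Set.univ)
    (hV : ∀ i, ∃ W : ℕ → Set X, (∀ m, IsOpen (W m)) ∧
      Pairwise (Function.onFun Disjoint W) ∧
      (∀ m, ∃ (k : ℕ) (U : Fin (k + 1) → Set X),
        (∀ j, U j ∈ 𝒰) ∧ W m = ⋃ j, U j) ∧
      V i = ⋃ m, W m) :
    P Set.univ := by
  have hinf : ∀ U ∈ infClosure 𝒰, P U := by
    rintro _ ⟨t, ht, hts, rfl⟩
    obtain ⟨n, hn⟩ := Nat.exists_eq_add_one.2 ht.card_pos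
    let e := t.equivFinOfCardEq hn
    have h := hloc n (fun i => (e.symm i : Set X)) fun i => hts (e.symm i).2
    rw [e.symm.surjective.iInter_comp (fun x : t => (x : Set X))] at h
    rwa [Finset.inf'_eq_inf, Finset.inf_set_eq_iInter,
      ← Set.iInter_subtype (· ∈ t) (fun x => id x.1)]
  have hinf_open : ∀ U ∈ infClosure 𝒰, IsOpen U := fun U hU =>
    infClosure_min (t := {U | IsOpen U}) (fun _ h => hbasis.isOpen h)
      (fun _ h _ h' => h.inter h') hU
  have hsup : ∀ U ∈ supClosure (infClosure 𝒰), P U := by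
    rintro _ ⟨t, ht, hts, rfl⟩
    exact sup'_of_infClosed hMV infClosed_infClosure hinf_open hinf ht id fun i hi => hts hi
  have hsup_open : ∀ U ∈ supClosure (infClosure 𝒰), IsOpen U := fun U hU =>
    supClosure_min (t := {U | IsOpen U}) hinf_open (fun _ h _ h' => h.union h') hU
  have hV' : Finset.univ.sup' Finset.univ_nonempty V = Set.univ := by
    rw [← hcover, Finset.sup'_eq_sup, Finset.sup_univ_eq_iSup]
    rfl
  rw [← hV']
  refine sup'_of_infClosed hMV
    (infClosed_iUnion_disjoint (infClosed_infClosure (s := 𝒰)).supClosure) ?_ ?_ _ V ?_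
  · rintro _ ⟨W, hW, -, rfl⟩
    exact isOpen_iUnion fun m => hsup_open _ (hW m)
  · rintro _ ⟨W, hW, hWd, rfl⟩
    exact hdisj W (fun m => hsup_open _ (hW m)) hWd fun m => hsup _ (hW m)
  · rintro i -
    obtain ⟨W, -, hWd, hW, hVi⟩ := hV i
    refine ⟨W, fun m => ?_, hWd, hVi⟩
    obtain ⟨k, U, hU, hWm⟩ := hW m
    rw [hWm, ← Set.iSup_eq_iUnion, ← Finset.sup_univ_eq_iSup,
      ← Finset.sup'_eq_sup Finset.univ_nonempty]
    exact supClosed_supClosure.finsetSup'_mem _ fun j _ =>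
      subset_supClosure (subset_infClosure (hU j))
end
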